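/- Let D be an integral domain with field of fractions K, and let V be a valuation overring of D with maximal ideal 𝔪_V such that V is an essential overring of D (i.e., V = D_𝔭 for some prime ideal 𝔭 of D) centered on a maximal ideal of D (i.e., 𝔪_V ∩ D is a maximal ideal of D). If the residue field of V is algebraically closed and 𝔪_V is not a principal ideal of V, then IntR(D) is not a Prüfer domain. -/

import Mathlib

open Polynomial

/-- `φ ∈ IntR(V)`: the rational function `φ ∈ K(x)` is defined at, and takes a value in `V`
at, every element of `V`. -/
def IntegerValued {K : Type*} [Field K] (V : ValuationSubring K) (φ : RatFunc K) : Prop :=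
  ∀ a : K, a ∈ V → φ.denom.eval a ≠ 0 ∧ φ.num.eval a / φ.denom.eval a ∈ V

/-- A subring (given as a subset `R` of its fraction field `F`) is a Prüfer domain:
every nonzero finitely generated ideal `(a₁, …, aₙ)` is invertible, i.e. there are
`b₁, …, bₙ ∈ F` with every `bᵢaⱼ ∈ R` and `∑ bᵢaᵢ = 1`. -/
def IsPruferSet (F : Type*) [Field F] (R : Set F) : Prop :=
  ∀ (n : ℕ) (a : Fin n → F), (∀ i, a i ∈ R) → (∃ i, a i ≠ 0) →
    ∃ b : Fin n → F, (∀ i j, b i * a j ∈ R) ∧ ∑ i, b i * a i = 1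

/-- The inclusion ring homomorphism of a subring `D` of `K` into a valuation overring `V`. -/
def inclDV {K : Type*} [Field K] (D : Subring K) (V : ValuationSubring K)
    (h : ∀ x : K, x ∈ D → x ∈ V) : ↥D →+* ↥V where
  toFun d := ⟨(d : K), h _ d.2⟩
  map_one' := rfl
  map_mul' _ _ := rfl
  map_zero' := rfl
  map_add' _ _ := rfl

/-- `P z` holds for all `z` in the maximal ideal with `v z` close enough to `1`. -/
def EvClose {K : Type*} [Field K] (V : ValuationSubring K) (P : K → Prop) : Prop :=
  ∃ s : K, V.valuation s < 1 ∧ ∀ z : K, V.valuation s < V.valuation z → V.valuation z < 1 → P z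

theorem EvClose.and {K : Type*} [Field K] {V : ValuationSubring K} {P Q : K → Prop}
    (hP : EvClose V P) (hQ : EvClose V Q) : EvClose V (fun z => P z ∧ Q z) := by
  obtain ⟨s, hs, h⟩ := hP
  obtain ⟨r, hr, h'⟩ := hQ
  rcases le_total (V.valuation s) (V.valuation r) with hle | hle
  · exact ⟨r, hr, fun z hz hz1 => ⟨h z (hle.trans_lt hz) hz1, h' z hz hz1⟩⟩
  · exact ⟨s, hs, fun z hz hz1 => ⟨h z hz hz1, h' z (hle.trans_lt hz) hz1⟩⟩

theorem EvClose.of_forall {K : Type*} [Field K] {V : ValuationSubring K} {P : K → Prop}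
    (h : ∀ z, V.valuation z < 1 → P z) : EvClose V P :=
  ⟨0, by simp, fun z _ hz => h z hz⟩

theorem EvClose.mono {K : Type*} [Field K] {V : ValuationSubring K} {P Q : K → Prop}
    (hP : EvClose V P) (h : ∀ z, V.valuation z < 1 → V.valuation z ≠ 0 → P z → Q z) :
    EvClose V Q := by
  obtain ⟨s, hs, h'⟩ := hP
  exact ⟨s, hs, fun z hz hz1 => h z hz1 (ne_bot_of_gt hz) (h' z hz hz1)⟩

theorem EvClose.finset {K : Type*} [Field K] {V : ValuationSubring K} {ι : Type*}
    (S : Finset ι) {P : ι → K → Prop}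
    (hP : ∀ i ∈ S, EvClose V (P i)) : EvClose V (fun z => ∀ i ∈ S, P i z) := by
  classical
  induction S using Finset.induction_on with
  | empty => exact EvClose.of_forall (by simp)
  | insert a S ha ih =>
    refine ((hP a (by simp)).and (ih fun i hi => hP i (by simp [hi]))).mono ?_
    intro z _ _ h i hi
    rcases Finset.mem_insert.1 hi with rfl | hi
    · exact h.1
    · exact h.2 i hi

/-- The value group is dense near `1`. -/
def DenseOne {K : Type*} [Field K] (V : ValuationSubring K) : Prop :=
  ∀ s : K, V.valuation s < 1 → ∃ z, V.valuation s < V.valuation z ∧ V.valuation z < 1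

theorem denseOne_of_not_principal {K : Type*} [Field K] (V : ValuationSubring K)
    (hnp : ¬ (IsLocalRing.maximalIdeal ↥V).IsPrincipal) : DenseOne V := by
  intro s hs
  by_contra! hcon
  apply hnp
  have hsV : s ∈ V := (V.valuation_le_one_iff s).1 hs.le
  refine ⟨⟨⟨s, hsV⟩, ?_⟩⟩
  apply le_antisymm
  · intro x hx
    rw [V.valuation_lt_one_iff] at hx
    have : V.valuation x ≤ V.valuation s := by
      by_contra! h
      exact absurd hx (not_lt.2 (hcon _ h))
    obtain ⟨a, ha⟩ := (V.valuation_le_iff _ _).1 this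
    refine Submodule.mem_span_singleton.2 ⟨a, ?_⟩
    ext
    simpa using ha
  · rw [Submodule.span_singleton_le_iff_mem, V.valuation_lt_one_iff]
    exact hs

theorem EvClose.exists {K : Type*} [Field K] {V : ValuationSubring K} (hd : DenseOne V)
    {P : K → Prop} (hP : EvClose V P) :
    ∃ z, V.valuation z < 1 ∧ V.valuation z ≠ 0 ∧ P z := by
  obtain ⟨s, hs, h⟩ := hP
  obtain ⟨z, h1, h2⟩ := hd s hs
  exact ⟨z, h2, ne_bot_of_gt h1, h z h1 h2⟩

theorem exists_pow_gt {K : Type*} [Field K] {V : ValuationSubring K} (hd : DenseOne V)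
    (n : ℕ) : ∀ s : K, V.valuation s < 1 →
      ∃ r : K, V.valuation r < 1 ∧ V.valuation s < V.valuation r ^ n := by
  induction n with
  | zero => intro s hs; exact ⟨0, by simp, by simpa using hs⟩
  | succ n ih =>
    intro s hs
    obtain ⟨p, hp, hp1⟩ := hd s hs
    have hp0 : 0 < V.valuation p := lt_of_le_of_lt zero_le hp
    obtain ⟨r, hr, hr'⟩ := ih (s / p) (by rw [map_div₀]; exact (div_lt_one₀ hp0).2 hp)
    rw [map_div₀, div_lt_iff₀ hp0] at hr'
    rcases le_total (V.valuation p) (V.valuation r) with h | h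
    · refine ⟨r, hr, hr'.trans_le ?_⟩
      rw [pow_succ]; gcongr
    · refine ⟨p, hp1, hr'.trans_le ?_⟩
      rw [pow_succ]; gcongr

theorem evClose_pow {K : Type*} [Field K] {V : ValuationSubring K} (hd : DenseOne V)
    (n : ℕ) (s : K) (hs : V.valuation s < 1) :
    EvClose V (fun z => V.valuation s < V.valuation z ^ n) := by
  obtain ⟨r, hr, h⟩ := exists_pow_gt hd n s hs
  refine ⟨r, hr, fun z hz _ => h.trans_le ?_⟩
  gcongr

open IsLocalRing in
theorem res_zero_iff {K : Type*} [Field K] {V : ValuationSubring K} (a : V) :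
    residue V a = 0 ↔ V.valuation (a : K) < 1 := by
  rw [residue_eq_zero_iff, V.valuation_lt_one_iff]

open IsLocalRing in
theorem res_ne_zero_iff {K : Type*} [Field K] {V : ValuationSubring K} (a : V) :
    residue V a ≠ 0 ↔ V.valuation (a : K) = 1 := by
  rw [residue_ne_zero_iff_isUnit, V.valuation_eq_one_iff]

theorem val_aeval_eq {K : Type*} [Field K] {V : ValuationSubring K} (P : (↥V)[X]) (n : ℕ) (y : K)
    (hn : V.valuation (P.coeff n : K) = 1) (hy : V.valuation y ≠ 0)
    (h : ∀ i ∈ P.support, i ≠ n →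
      V.valuation (P.coeff i : K) * V.valuation y ^ i < V.valuation y ^ n) :
    V.valuation (aeval y P) = V.valuation y ^ n := by
  have hmem : n ∈ P.support := by
    rw [mem_support_iff]; intro h0; simp [h0] at hn
  have hsum : aeval y P = (P.coeff n : K) * y ^ n
      + ∑ i ∈ P.support.erase n, (P.coeff i : K) * y ^ i := by
    rw [aeval_def, eval₂_eq_sum, Polynomial.sum, ← Finset.add_sum_erase _ _ hmem]
    rfl
  have hlt : V.valuation (∑ i ∈ P.support.erase n, (P.coeff i : K) * y ^ i)
      < V.valuation y ^ n := by
    apply Valuation.map_sum_lt _ (pow_ne_zero _ hy)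
    intro i hi
    rw [Finset.mem_erase] at hi
    rw [map_mul, map_pow]
    exact h i hi.2 hi.1
  have hmain : V.valuation ((P.coeff n : K) * y ^ n) = V.valuation y ^ n := by
    rw [map_mul, map_pow, hn, one_mul]
  rw [hsum, Valuation.map_add_eq_of_lt_left _ (by rwa [hmain]), hmain]

open IsLocalRing in
theorem evClose_zero {K : Type*} [Field K] {V : ValuationSubring K} (hd : DenseOne V)
    (P : (↥V)[X]) (hP : P.map (residue V) ≠ 0) :
    EvClose V (fun z => ∀ y, V.valuation y = V.valuation z →
      V.valuation (aeval y P) = V.valuation z ^ (P.map (residue V)).natTrailingDegree) := by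
  set n := (P.map (residue V)).natTrailingDegree with hn
  have hcn : V.valuation (P.coeff n : K) = 1 := by
    rw [← res_ne_zero_iff, ← coeff_map]
    exact mt trailingCoeff_eq_zero.1 hP
  have hlow : ∀ i, i < n → V.valuation (P.coeff i : K) < 1 := by
    intro i hi
    rw [← res_zero_iff, ← coeff_map]
    exact coeff_eq_zero_of_lt_natTrailingDegree hi
  refine (EvClose.finset (Finset.range n)
    (fun i hi => evClose_pow hd n (P.coeff i : K) (hlow i (Finset.mem_range.1 hi)))).mono ?_
  intro z hz hz0 h y hy
  rw [← hy] at hz hz0 h ⊢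
  apply val_aeval_eq P n y hcn hz0
  intro i _ hin
  rcases lt_or_gt_of_ne hin with hi | hi
  · calc _ ≤ V.valuation (P.coeff i : K) * 1 := by
          gcongr; exact pow_le_one₀ zero_le hz.le
      _ < _ := by rw [mul_one]; exact h i (Finset.mem_range.2 hi)
  · calc _ ≤ 1 * V.valuation y ^ i := by
          gcongr; exact V.valuation_le_one _
      _ < _ := by
          rw [one_mul]
          exact pow_lt_pow_right_of_lt_one₀ (zero_lt_iff.2 hz0) hz hi

open IsLocalRing in
theorem evClose_infty {K : Type*} [Field K] {V : ValuationSubring K} (hd : DenseOne V)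
    (P : (↥V)[X]) (hP : P.map (residue V) ≠ 0) :
    EvClose V (fun z => ∀ y, V.valuation y = (V.valuation z)⁻¹ →
      V.valuation (aeval y P) = V.valuation y ^ (P.map (residue V)).natDegree) := by
  set n := (P.map (residue V)).natDegree with hn
  have hcn : V.valuation (P.coeff n : K) = 1 := by
    rw [← res_ne_zero_iff, ← coeff_map]
    exact mt leadingCoeff_eq_zero.1 hP
  have hhigh : ∀ i, n < i → V.valuation (P.coeff i : K) < 1 := by
    intro i hi
    rw [← res_zero_iff, ← coeff_map]
    exact coeff_eq_zero_of_natDegree_lt hi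
  refine (EvClose.finset (P.support.filter (n < ·))
    (fun i hi => evClose_pow hd i (P.coeff i : K) (hhigh i (Finset.mem_filter.1 hi).2))).mono ?_
  intro z hz hz0 h y hy
  have hzpos := zero_lt_iff.2 hz0
  have hy1 : 1 < V.valuation y := by rw [hy]; exact (one_lt_inv₀ hzpos).2 hz
  have hy0 : V.valuation y ≠ 0 := ne_bot_of_gt hy1
  apply val_aeval_eq P n y hcn hy0
  intro i his hin
  rcases lt_or_gt_of_ne hin with hi | hi
  · calc _ ≤ 1 * V.valuation y ^ i := by
          gcongr; exact V.valuation_le_one _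
      _ < _ := by
          rw [one_mul]
          exact pow_lt_pow_right₀ hy1 hi
  · have h1 := h i (Finset.mem_filter.2 ⟨his, hi⟩)
    have h2 : V.valuation (P.coeff i : K) * V.valuation y ^ i < 1 := by
      rw [hy, inv_pow, ← div_eq_mul_inv]
      exact (div_lt_one₀ (pow_pos hzpos _)).2 h1
    exact h2.trans_le (one_le_pow₀ hy1.le)

open IsLocalRing in
theorem core_contra {K : Type*} [Field K] {V : ValuationSubring K} (hd : DenseOne V)
    [IsAlgClosed (ResidueField V)] (D : Subring K) (t : K) (ht0 : t ≠ 0)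
    (ht1 : V.valuation t < 1) (ht : t ∈ D)
    (hlift : ∀ c : ResidueField V, ∃ d : V, (d : K) ∈ D ∧ residue V d = c)
    (hval : ∀ x ∈ V, ∃ d ∈ D, V.valuation d = V.valuation x)
    (F G : (↥V)[X]) (hprim : F.map (residue V) ≠ 0 ∨ G.map (residue V) ≠ 0)
    (h1 : ∀ y, t * y ∈ D → V.valuation (aeval y F) ≤ V.valuation (aeval y G))
    (h2 : ∀ y, t * y ∈ D → V.valuation y < 1 →
      V.valuation (aeval y F) < V.valuation (aeval y G))
    (h3 : ∀ y, t * y ∈ D → 1 < V.valuation y →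
      V.valuation (aeval y (F - G)) < V.valuation (aeval y G)) : False := by
  have haev : ∀ (P : (↥V)[X]) (y : V), aeval (y : K) P = ((P.eval y : V) : K) := by
    intro P y
    exact aeval_algebraMap_apply_eq_algebraMap_eval (A := K) y P
  have hVt : V.valuation t ≠ 0 := by simpa using ht0
  -- `G` does not reduce to zero
  have hG : G.map (residue V) ≠ 0 := by
    intro hG0
    have hF : F.map (residue V) ≠ 0 := hprim.resolve_right (by simpa using hG0)
    have : Infinite (ResidueField V) := IsAlgClosed.instInfinite
    obtain ⟨c, hc⟩ : ∃ c, (F.map (residue V)).eval c ≠ 0 := by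
      by_contra! hcon
      exact hF (Polynomial.funext (by simpa using hcon))
    obtain ⟨d, hdD, rfl⟩ := hlift c
    have hle := h1 d (D.mul_mem ht hdD)
    rw [haev, haev] at hle
    rw [eval_map_apply, res_ne_zero_iff] at hc
    have hg : V.valuation ((G.eval d : V) : K) < 1 := by
      rw [← res_zero_iff, ← eval_map_apply, hG0, eval_zero]
    rw [hc] at hle
    exact absurd hg (not_lt.2 hle)
  -- `F - G` reduces to zero
  have hH : (F - G).map (residue V) = 0 := by
    by_contra hH
    have hdvd : G.map (residue V) ∣ (F - G).map (residue V) := by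
      classical
      rw [IsAlgClosed.dvd_iff_roots_le_roots hG hH, Multiset.le_iff_count]
      intro c
      rw [count_roots, count_roots]
      obtain ⟨d, hdD, rfl⟩ := hlift c
      have key : ∀ P : (↥V)[X], P.map (residue V) ≠ 0 →
          EvClose V (fun z => ∀ y, V.valuation y = V.valuation z →
          V.valuation (aeval (y + d) P) = V.valuation z ^
            (P.map (residue V)).rootMultiplicity (residue V d)) := by
        intro P hP
        have h := evClose_zero hd (taylor d P) (by
          rw [map_taylor]
          exact fun h => hP (taylor_injective (residue V d) (by simpa using h)))
        rw [map_taylor, taylor_apply (residue V d), ← rootMultiplicity_eq_natTrailingDegree] at h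
        refine h.mono fun z _ _ hz y hy => ?_
        rw [← hz y hy, taylor_apply, aeval_comp]
        simp
      obtain ⟨z, hz1, hz0, hzG, hzH⟩ := ((key _ hG).and (key _ hH)).exists hd
      obtain ⟨y, hyD, hy⟩ := hval z ((V.valuation_le_one_iff z).1 hz1.le)
      have hmem : t * (y + d) ∈ D := D.mul_mem ht (D.add_mem hyD hdD)
      have hle : V.valuation (aeval (y + d) (F - G)) ≤ V.valuation (aeval (y + (d : K)) G) := by
        rw [map_sub]
        exact (V.valuation.map_sub _ _).trans (max_le (h1 _ hmem) le_rfl)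
      rw [hzG y hy, hzH y hy] at hle
      exact (pow_le_pow_iff_right_of_lt_one₀ (zero_lt_iff.2 hz0) hz1).1 hle
    have hdeg := natDegree_le_of_dvd hdvd hH
    obtain ⟨z, hz1, hz0, ⟨hzG, hzH⟩, hzt⟩ := (((evClose_infty hd G hG).and
      (evClose_infty hd _ hH)).and (evClose_pow hd 1 t ht1)).exists hd
    have hz0' : z ≠ 0 := by rintro rfl; simp at hz0
    have hzpos := zero_lt_iff.2 hz0
    rw [pow_one] at hzt
    obtain ⟨a, haD, ha⟩ := hval (t / z) (by
      rw [← V.valuation_le_one_iff, map_div₀]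
      exact ((div_lt_one₀ hzpos).2 hzt).le)
    have hy : V.valuation (a / t) = (V.valuation z)⁻¹ := by
      rw [map_div₀, ha, map_div₀]; field_simp
    have hy1 : 1 < V.valuation (a / t) := by rw [hy]; exact (one_lt_inv₀ hzpos).2 hz1
    have := h3 (a / t) (by rwa [mul_div_cancel₀ _ ht0]) hy1
    rw [hzG _ hy, hzH _ hy] at this
    exact absurd ((pow_lt_pow_iff_right₀ hy1).1 this) (not_lt.2 hdeg)
  have hFG : F.map (residue V) = G.map (residue V) := by
    rw [Polynomial.map_sub] at hH; exact sub_eq_zero.1 hH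
  obtain ⟨z, hz1, hz0, hzF, hzG⟩ := ((evClose_zero hd F (by rwa [hFG])).and
    (evClose_zero hd G hG)).exists hd
  obtain ⟨y, hyD, hy⟩ := hval z ((V.valuation_le_one_iff z).1 hz1.le)
  have := h2 y (D.mul_mem ht hyD) (by rwa [hy])
  rw [hzF y hy, hzG y hy, hFG] at this
  exact lt_irrefl _ this

theorem zero_notMem_coeffs_aux {K : Type*} [Field K] (p : K[X]) : (0 : K) ∉ p.coeffs := by
  intro h
  obtain ⟨n, hn, h0⟩ := mem_coeffs_iff.1 h
  exact (mem_support_iff.1 hn) h0.symm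

open IsLocalRing in
theorem exists_scale {K : Type*} [Field K] (V : ValuationSubring K) (f g : K[X]) (hg : g ≠ 0) :
    ∃ (c : K) (F G : (↥V)[X]), c ≠ 0 ∧ F.map (algebraMap V K) = C c * f ∧
      G.map (algebraMap V K) = C c * g ∧
      (F.map (residue V) ≠ 0 ∨ G.map (residue V) ≠ 0) := by
  classical
  let S : Finset K := f.coeffs ∪ g.coeffs
  have hS : S.Nonempty := by
    refine ⟨g.leadingCoeff, Finset.mem_union_right _ ?_⟩
    exact coeff_mem_coeffs (by simpa using hg)
  obtain ⟨m, hm, hmax⟩ := Finset.exists_max_image S V.valuation hS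
  have hm0 : m ≠ 0 := by
    rcases Finset.mem_union.1 hm with h | h
    · rintro rfl; exact zero_notMem_coeffs_aux _ h
    · rintro rfl; exact zero_notMem_coeffs_aux _ h
  have hvm : 0 < V.valuation m := zero_lt_iff.2 (by simpa using hm0)
  have hlift : ∀ p : K[X], p.coeffs ⊆ S → ∃ P : (↥V)[X], P.map (algebraMap V K) = C m⁻¹ * p := by
    intro p hp
    apply (lifts_iff_coeff_lifts _).2
    intro n
    have : m⁻¹ * p.coeff n ∈ V := by
      rw [← V.valuation_le_one_iff, map_mul, map_inv₀, mul_comm, ← div_eq_mul_inv]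
      refine (div_le_one₀ hvm).2 ?_
      by_cases h0 : p.coeff n = 0
      · simp [h0]
      · exact hmax _ (hp (coeff_mem_coeffs h0))
    exact ⟨⟨_, this⟩, by rw [coeff_C_mul]; rfl⟩
  have hne : ∀ (p : K[X]) (P : (↥V)[X]), P.map (algebraMap V K) = C m⁻¹ * p → m ∈ p.coeffs →
      P.map (residue V) ≠ 0 := by
    intro p P hP hmp h0
    obtain ⟨n, _, hn⟩ := mem_coeffs_iff.1 hmp
    have h1 : (P.coeff n : K) = 1 := by
      have := congrArg (fun q => coeff q n) hP
      simp only [coeff_map, coeff_C_mul, ← hn, inv_mul_cancel₀ hm0] at this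
      exact this
    have h2 : residue V (P.coeff n) = 0 := by rw [← coeff_map, h0, coeff_zero]
    rw [res_zero_iff, h1, map_one] at h2
    exact lt_irrefl _ h2
  obtain ⟨F, hF⟩ := hlift f Finset.subset_union_left
  obtain ⟨G, hG⟩ := hlift g Finset.subset_union_right
  refine ⟨m⁻¹, F, G, inv_ne_zero hm0, hF, hG, ?_⟩
  rcases Finset.mem_union.1 hm with h | h
  · exact Or.inl (hne f F hF h)
  · exact Or.inr (hne g G hG h)

/-- Let `D` be an integral domain with field of fractions `K`, and let `V` be
a valuation overring of `D` which is essential for `D` (i.e. `V = D_𝔭` for some prime `𝔭`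
of `D`) and centered on a maximal ideal of `D` (i.e. `𝔪_V ∩ D` is a maximal ideal of `D`).
If the residue field of `V` is algebraically closed and `𝔪_V` is not principal, then
`IntR(D)` is not a Prüfer domain. -/
theorem statement19 (K : Type*) [Field K] (D : Subring K) (V : ValuationSubring K)
    (hDV : ∀ x : K, x ∈ D → x ∈ V)
    (hfrac : ∀ x : K, ∃ a b : ↥D, b ≠ 0 ∧ x * (b : K) = (a : K))
    (𝔭 : Ideal ↥D) (h𝔭 : 𝔭.IsPrime)
    (hess : ∀ x : K, x ∈ V ↔ ∃ a b : ↥D, b ∉ 𝔭 ∧ x * (b : K) = (a : K))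
    (hcenter : (Ideal.comap (inclDV D V hDV) (IsLocalRing.maximalIdeal ↥V)).IsMaximal)
    (halg : IsAlgClosed (IsLocalRing.ResidueField ↥V))
    (hnp : ¬ (IsLocalRing.maximalIdeal ↥V).IsPrincipal) :
    ¬ IsPruferSet (RatFunc K)
      {φ | ∀ a : K, a ∈ D → φ.denom.eval a ≠ 0 ∧ φ.num.eval a / φ.denom.eval a ∈ D} := by
  intro hpruf
  have hd := denseOne_of_not_principal V hnp
  set R : Set (RatFunc K) :=
    {φ | ∀ a : K, a ∈ D → φ.denom.eval a ≠ 0 ∧ φ.num.eval a / φ.denom.eval a ∈ D} with hR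
  -- elements outside `𝔭` have value one
  have hunit : ∀ b : D, b ∉ 𝔭 → V.valuation (b : K) = 1 := by
    intro b hb
    have hb0 : (b : K) ≠ 0 := by
      intro h
      apply hb
      have : b = 0 := by ext; simpa using h
      rw [this]; exact 𝔭.zero_mem
    apply le_antisymm ((V.valuation_le_one_iff _).2 (hDV _ b.2))
    have hinv : (b : K)⁻¹ ∈ V := (hess _).2 ⟨1, b, hb, by simp [hb0]⟩
    rw [← V.valuation_le_one_iff, map_inv₀] at hinv
    exact (inv_le_one₀ (zero_lt_iff.2 (by simpa using hb0))).1 hinv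
  have hval : ∀ x ∈ V, ∃ d ∈ D, V.valuation d = V.valuation x := by
    intro x hx
    obtain ⟨a, b, hb, hab⟩ := (hess x).1 hx
    exact ⟨a, a.2, by rw [← hab, map_mul, hunit b hb, mul_one]⟩
  have hlift : ∀ c : IsLocalRing.ResidueField V,
      ∃ d : V, (d : K) ∈ D ∧ IsLocalRing.residue V d = c := by
    intro c
    obtain ⟨x, rfl⟩ := IsLocalRing.residue_surjective c
    obtain ⟨a, b, hb, hab⟩ := (hess x).1 x.2
    have hbm : b ∉ Ideal.comap (inclDV D V hDV) (IsLocalRing.maximalIdeal ↥V) := by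
      intro hmem
      rw [Ideal.mem_comap, V.valuation_lt_one_iff] at hmem
      exact absurd (hunit b hb) hmem.ne
    obtain ⟨e, he⟩ := Ideal.IsMaximal.exists_inv hcenter hbm
    obtain ⟨i, hi, hei⟩ := he
    refine ⟨inclDV D V hDV (a * e), (a * e).2, ?_⟩
    have hxb : x * inclDV D V hDV b = inclDV D V hDV a := by ext; exact hab
    have hi0 : IsLocalRing.residue V (inclDV D V hDV i) = 0 :=
      (IsLocalRing.residue_eq_zero_iff _).2 hi
    have h1 : IsLocalRing.residue V (inclDV D V hDV (e * b)) = 1 := by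
      have := congrArg (fun q => IsLocalRing.residue V (inclDV D V hDV q)) hei
      simpa only [map_add, hi0, add_zero, map_one] using this
    rw [map_mul, ← hxb]
    rw [map_mul] at h1
    rw [show x * inclDV D V hDV b * inclDV D V hDV e
      = x * (inclDV D V hDV e * inclDV D V hDV b) by ring, map_mul, h1, mul_one]
  -- choose `t`
  obtain ⟨t, ht, ht0, ht1⟩ : ∃ t ∈ D, t ≠ 0 ∧ V.valuation t < 1 := by
    obtain ⟨z, hz0, hz1⟩ := hd 0 (by simp)
    obtain ⟨t, ht, htz⟩ := hval z ((V.valuation_le_one_iff z).1 hz1.le)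
    refine ⟨t, ht, ?_, by rwa [htz]⟩
    rintro rfl
    rw [← htz] at hz0
    exact lt_irrefl _ hz0
  have hVt : 0 < V.valuation t := zero_lt_iff.2 (by simpa using ht0)
  obtain ⟨b, hb, hsum⟩ := hpruf 2 ![RatFunc.X, RatFunc.C t] (by
    intro i
    fin_cases i
    · intro a ha; simpa using ha
    · intro a ha; simpa using ht) ⟨0, by simpa using RatFunc.X_ne_zero⟩
  have hb00 := hb 0 0
  have hb01 := hb 0 1
  have hb10 := hb 1 0
  have hb11 := hb 1 1
  simp only [Matrix.cons_val_zero, Matrix.cons_val_one, Fin.sum_univ_two] at hb00 hb01 hb10 hb11 hsum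
  set ψ := b 0 * RatFunc.X with hψ
  set χ := b 1 * RatFunc.C t with hχ
  have hC : RatFunc.C t ≠ 0 := by simpa using ht0
  let ev : K → RatFunc K → K := fun a φ => RatFunc.eval (RingHom.id K) a φ
  have hev : ∀ a ∈ D, ∀ φ ∈ R, φ.denom.eval₂ (RingHom.id K) a ≠ 0 ∧ ev a φ ∈ D := by
    intro a ha φ hφ
    exact hφ a ha
  have hevV : ∀ a ∈ D, ∀ φ ∈ R, V.valuation (ev a φ) ≤ 1 := fun a ha φ hφ =>
    (V.valuation_le_one_iff _).2 (hDV _ (hev a ha φ hφ).2)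
  have hψ1 : ∀ a ∈ D, ev a ψ * t = ev a (b 0 * RatFunc.C t) * a := by
    intro a ha
    have e : ψ * RatFunc.C t = (b 0 * RatFunc.C t) * RatFunc.X := by rw [hψ]; ring
    have := congrArg (ev a) e
    simp only [ev] at this
    rw [RatFunc.eval_mul _ _ (hev a ha _ hb00).1 (by simp),
      RatFunc.eval_mul _ _ (hev a ha _ hb01).1 (by simp)] at this
    simpa using this
  have hχ1 : ∀ a ∈ D, ev a χ * a = ev a (b 1 * RatFunc.X) * t := by
    intro a ha
    have e : χ * RatFunc.X = (b 1 * RatFunc.X) * RatFunc.C t := by rw [hχ]; ring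
    have := congrArg (ev a) e
    simp only [ev] at this
    rw [RatFunc.eval_mul _ _ (hev a ha _ hb11).1 (by simp),
      RatFunc.eval_mul _ _ (hev a ha _ hb10).1 (by simp)] at this
    simpa using this
  have hψχ : ∀ a ∈ D, ev a ψ + ev a χ = 1 := by
    intro a ha
    have := congrArg (ev a) hsum
    simp only [ev] at this
    rw [RatFunc.eval_add _ _ (hev a ha _ hb00).1 (hev a ha _ hb11).1] at this
    simpa using this
  obtain ⟨c, F, G, hc0, hF, hG, hprim⟩ := exists_scale V (ψ.num.comp (C t * X))
    (ψ.denom.comp (C t * X)) (by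
      intro h
      rw [comp_eq_zero_iff] at h
      rcases h with h | ⟨_, h⟩
      · exact ψ.denom_ne_zero h
      · have := congrArg (fun q => coeff q 1) h
        simp at this
        exact ht0 this)
  have hFe : ∀ y, aeval y F = c * ψ.num.eval (t * y) := by
    intro y
    rw [aeval_def, ← eval_map, hF]; simp
  have hGe : ∀ y, aeval y G = c * ψ.denom.eval (t * y) := by
    intro y
    rw [aeval_def, ← eval_map, hG]; simp
  have hG0 : ∀ y, t * y ∈ D → aeval y G ≠ 0 := by
    intro y hy
    rw [hGe]; exact mul_ne_zero hc0 (hb00 _ hy).1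
  have hFG : ∀ y, t * y ∈ D → aeval y F = ev (t * y) ψ * aeval y G := by
    intro y hy
    have h := (hb00 _ hy).1
    change _ = (ψ.num.eval (t * y) / ψ.denom.eval (t * y)) * _
    rw [hFe, hGe]; field_simp
  have hGpos : ∀ y, t * y ∈ D → 0 < V.valuation (aeval y G) := fun y hy =>
    zero_lt_iff.2 (by simpa using hG0 y hy)
  refine core_contra hd D t ht0 ht1 ht hlift hval F G hprim ?_ ?_ ?_
  · intro y hy
    rw [hFG y hy, map_mul]
    exact mul_le_of_le_one_left' (hevV _ hy _ hb00)
  · intro y hy hy1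
    rw [hFG y hy, map_mul]
    refine mul_lt_of_lt_one_left (hGpos y hy) ?_
    have h := hψ1 _ hy
    have h' : ev (t * y) ψ = ev (t * y) (b 0 * RatFunc.C t) * y := by
      apply mul_right_cancel₀ ht0
      rw [h]; ring
    rw [h', map_mul]
    exact (mul_le_of_le_one_left' (hevV _ hy _ hb01)).trans_lt hy1
  · intro y hy hy1
    have hsub : aeval y (F - G) = - ev (t * y) χ * aeval y G := by
      rw [map_sub, hFG y hy]
      linear_combination aeval y G * hψχ _ hy
    rw [hsub, map_mul, Valuation.map_neg]
    refine mul_lt_of_lt_one_left (hGpos y hy) ?_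
    have h := hχ1 _ hy
    have h' : ev (t * y) χ * y = ev (t * y) (b 1 * RatFunc.X) := by
      apply mul_right_cancel₀ ht0
      rw [← h]; ring
    have h2 := hevV _ hy _ hb10
    rw [← h', map_mul] at h2
    by_contra! hcon
    exact absurd h2 (not_le.2 (hy1.trans_le (le_mul_of_one_le_left' hcon)))
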